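/- arXiv:2105.04864 — 2 statements merged into one kernel-verified Lean document; each statement's English description precedes it below -/
import Mathlib

section
/- Let k ≥ 1 be an integer, and for each i = 1, …, k let a_i < b_i and y_i be real numbers such that the closed intervals [a_1, b_1], …, [a_k, b_k] are pairwise disjoint and y_1, …, y_k are pairwise distinct. Let P = ⋃_{i=1}^k ([a_i, b_i] × {y_i}) (a disjoint union of horizontal segments with no two points sharing an x-coordinate and no two segments sharing a y-coordinate). Then there exists a constant C > 0 (depending on P) such that px(n, P) ≤ C·n for every real n ≥ 1. -/
open MeasureTheory Set
open scoped ENNReal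

/-- `S` contains `P` (for subsets of `ℝ²`). -/
def PContains (S P : Set (ℝ × ℝ)) : Prop :=
  ∃ fX fY : ℝ → ℝ,
    (∀ x₀ x₁ : ℝ, (∃ y, (x₀, y) ∈ P) → (∃ y, (x₁, y) ∈ P) → x₁ < x₀ →
      x₀ - x₁ ≤ fX x₀ - fX x₁) ∧
    (∀ y₀ y₁ : ℝ, (∃ x, (x, y₀) ∈ P) → (∃ x, (x, y₁) ∈ P) → y₁ < y₀ →
      y₀ - y₁ ≤ fY y₀ - fY y₁) ∧
    (∀ p ∈ P, (fX p.1, fY p.2) ∈ S)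

/-- `px n P`: supremum of the planar Lebesgue measure of open `P`-free subsets of `[0,n]²`. -/
noncomputable def px (n : ℝ) (P : Set (ℝ × ℝ)) : ℝ≥0∞ :=
  sSup {m : ℝ≥0∞ | ∃ S : Set (ℝ × ℝ), IsOpen S ∧ S ⊆ Set.Icc (0, 0) (n, n) ∧
    ¬ PContains S P ∧ m = volume S}

/-- The elements of `T` encode the integer intervals `[l x, r x]`, each placed in row `row x`,
and intervals in the same row are disjoint. -/
def IsIntervalFamily {ι : Type*} (T : Finset ι) (row l r : ι → ℕ) : Prop :=
  (∀ x ∈ T, l x ≤ r x) ∧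
    ∀ x ∈ T, ∀ y ∈ T, x ≠ y → row x = row y → r x < l y ∨ r y < l x

/-- `T` has `k` intervals whose left-to-right order is given by `α` and whose rows are
ordered by `β`. -/
def HasPattern {ι : Type*} {k : ℕ} (α β : Fin k → ℕ) (T : Finset ι) (row l r : ι → ℕ) : Prop :=
  ∃ X : Fin k → ι, (∀ i, X i ∈ T) ∧ (∀ i j, α i < α j → r (X i) < l (X j)) ∧
    ∀ i j, β i < β j → row (X i) < row (X j)

theorem exists_sorted_enumeration {ι : Type*} (Z : Finset ι) (f : ι → ℕ)
    (hf : Set.InjOn f Z) (n : ℕ) (hn : 0 < n) (hnZ : n ≤ Z.card) :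
    ∃ e : ℕ → ι, (∀ i < n, e i ∈ Z) ∧ ∀ i j, i < j → j < n → f (e i) < f (e j) := by
  classical
  have hc : (Z.image f).card = Z.card := Finset.card_image_of_injOn hf
  have key : ∀ i : Fin Z.card, ∃ x ∈ Z, f x = (Z.image f).orderEmbOfFin hc i := by
    intro i
    obtain ⟨x, hx, hfx⟩ := Finset.mem_image.1 (Finset.orderEmbOfFin_mem (Z.image f) hc i)
    exact ⟨x, hx, hfx⟩
  choose e he hfe using key
  refine ⟨fun i => if h : i < Z.card then e ⟨i, h⟩ else e ⟨0, by omega⟩, ?_, ?_⟩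
  · intro i hi
    simp only [show i < Z.card by omega, dif_pos, he]
  · intro i j hij hj
    simp only [show i < Z.card by omega, show j < Z.card by omega, dif_pos, hfe]
    simpa using hij

/-- Greedy choice of disjoint intervals in each group: every interval `x` meets the right end of
the selected interval `φ x`, and lies to the right of all previously selected intervals. -/
theorem exists_greedy_disjoint_subfamily {ι : Type*} (g l r : ι → ℕ) (T : Finset ι)
    (hlr : ∀ x ∈ T, l x ≤ r x) :
    ∃ J ⊆ T, ∃ φ : ι → ι,
      (∀ x ∈ T, φ x ∈ J ∧ g (φ x) = g x ∧ l x ≤ r (φ x) ∧ r (φ x) ≤ r x) ∧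
      (∀ x ∈ T, ∀ z ∈ J, g z = g x → r z < r (φ x) → r z < l x) ∧
      IsIntervalFamily J g l r := by
  classical
  induction T using Finset.strongInduction with
  | H T ih =>
    rcases T.eq_empty_or_nonempty with rfl | hne
    · exact ⟨∅, by simp, id, by simp, by simp, by simp [IsIntervalFamily]⟩
    obtain ⟨m, hm, hmin⟩ := T.exists_min_image r hne
    set T' := T.filter (fun x => ¬ (g x = g m ∧ l x ≤ r m)) with hT'
    have hsub : T' ⊆ T := Finset.filter_subset _ _
    have hmT' : m ∉ T' := by simp [hT', hlr m hm]
    obtain ⟨J, hJ, φ, h1, h2, h3, h4⟩ :=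
      ih T' (Finset.ssubset_iff_subset_ne.2 ⟨hsub, fun h => hmT' (h ▸ hm)⟩)
        (fun x hx => hlr x (hsub hx))
    have hright : ∀ x ∈ T', g x = g m → r m < l x := by
      intro x hx hg
      have := (Finset.mem_filter.1 hx).2
      by_contra hcon
      exact this ⟨hg, by omega⟩
    refine ⟨insert m J, ?_, fun x => if x ∈ T' then φ x else m, ?_, ?_, ?_, ?_⟩
    · exact Finset.insert_subset hm (hJ.trans hsub)
    · intro x hx
      by_cases hxT : x ∈ T'
      · simp only [hxT, if_true]
        exact ⟨Finset.mem_insert_of_mem (h1 x hxT).1, (h1 x hxT).2⟩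
      · simp only [hxT, if_false]
        have : g x = g m ∧ l x ≤ r m := by
          by_contra hcon
          exact hxT (Finset.mem_filter.2 ⟨hx, hcon⟩)
        exact ⟨Finset.mem_insert_self _ _, this.1.symm, this.2, hmin x hx⟩
    · intro x hx z hz hg hlt
      by_cases hxT : x ∈ T'
      · simp only [hxT, if_true] at hlt
        rcases Finset.mem_insert.1 hz with rfl | hz
        · exact hright x hxT hg.symm
        · exact h2 x hxT z hz hg hlt
      · simp only [hxT, if_false] at hlt
        have := hmin z ((Finset.insert_subset hm (hJ.trans hsub)) hz)
        omega
    · intro x hx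
      exact hlr x ((Finset.insert_subset hm (hJ.trans hsub)) hx)
    · intro x hx y hy hxy hg
      rcases Finset.mem_insert.1 hx with rfl | hxJ <;> rcases Finset.mem_insert.1 hy with rfl | hyJ
      · exact absurd rfl hxy
      · exact Or.inl (hright y (hJ hyJ) hg.symm)
      · exact Or.inr (hright x (hJ hxJ) hg)
      · exact h4 x hxJ y hyJ hxy hg

theorem card_le_of_fiber_card_le {ι : Type*} [DecidableEq ι] (T J : Finset ι) (φ : ι → ι)
    (hφ : ∀ x ∈ T, φ x ∈ J) (p q : ℕ) (Z : Finset ι)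
    (hp : ∀ z ∈ J, z ∉ Z → (T.filter (fun x => φ x = z)).card ≤ p)
    (hq : ∀ z ∈ J, (T.filter (fun x => φ x = z)).card ≤ p + q) :
    T.card ≤ p * J.card + q * Z.card := by
  rw [Finset.card_eq_sum_card_fiberwise hφ]
  calc ∑ z ∈ J, (T.filter (fun x => φ x = z)).card
      ≤ ∑ z ∈ J, (p + if z ∈ Z then q else 0) := by
        refine Finset.sum_le_sum fun z hz => ?_
        by_cases hzZ : z ∈ Z
        · simpa [hzZ] using hq z hz
        · simpa [hzZ] using hp z hz hzZ
    _ = p * J.card + q * (J ∩ Z).card := by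
        rw [Finset.sum_add_distrib, Finset.sum_ite_mem]
        simp [mul_comm]
    _ ≤ _ := by gcongr; exact Finset.inter_subset_right

theorem exists_row_contraction {ι : Type*} {k : ℕ} (hk : 0 < k) (α β : Fin k → ℕ)
    (hα : ∀ i, α i < k) (hβ : ∀ i, β i < k) (H m : ℕ) (hH : 0 < H) (T : Finset ι) (row l r : ι → ℕ)
    (hT : IsIntervalFamily T row l r) (hrow : ∀ x ∈ T, row x < H * m)
    (hpat : ¬ HasPattern α β T row l r) :
    ∃ J ⊆ T, IsIntervalFamily J (fun x => row x / H) l r ∧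
      T.card ≤ (k - 1) * J.card + H * (m * 2 ^ H * (2 * k)) := by
  classical
  obtain ⟨J, hJT, φ, h1, h2, hJ⟩ :=
    exists_greedy_disjoint_subfamily (fun x => row x / H) l r T hT.1
  refine ⟨J, hJT, hJ, ?_⟩
  set fib : ι → Finset ι := fun z => T.filter (fun x => φ x = z) with hfib
  have fib_mem : ∀ z x, x ∈ fib z ↔ x ∈ T ∧ φ x = z := by simp [hfib]
  set offs : ι → Finset ℕ := fun z => (fib z).image (fun x => row x % H) with hoffs
  have offs_card : ∀ z, (offs z).card = (fib z).card := by
    intro z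
    refine Finset.card_image_of_injOn ?_
    intro x hx y hy hxy
    obtain ⟨hxT, rfl⟩ := (fib_mem z x).1 hx
    obtain ⟨hyT, hφ⟩ := (fib_mem _ y).1 hy
    by_contra hne
    have hrr : row x = row y := by
      have e1 := (h1 x hxT).2.1
      have e2 := (h1 y hyT).2.1
      rw [hφ] at e2
      simp only at hxy e1 e2
      rw [← Nat.div_add_mod (row x) H, ← Nat.div_add_mod (row y) H, hxy, ← e1, ← e2]
    have a1 := (h1 x hxT).2.2
    have a2 := (h1 y hyT).2.2
    rw [hφ] at a2
    rcases hT.2 x hxT y hyT hne hrr with h | h <;> omega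
  have offs_sub : ∀ z, offs z ⊆ Finset.range H := by
    intro z a ha
    obtain ⟨x, -, rfl⟩ := Finset.mem_image.1 ha
    exact Finset.mem_range.2 (Nat.mod_lt _ hH)
  set Z := J.filter (fun z => k ≤ (fib z).card) with hZ
  have hZcard : Z.card ≤ m * 2 ^ H * (2 * k) := by
    by_contra hcon
    have hmaps : ∀ z ∈ Z, (row z / H, offs z) ∈ Finset.range m ×ˢ (Finset.range H).powerset := by
      intro z hz
      refine Finset.mem_product.2 ⟨Finset.mem_range.2 ?_, Finset.mem_powerset.2 (offs_sub z)⟩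
      exact Nat.div_lt_of_lt_mul (hrow z (hJT (Finset.mem_filter.1 hz).1))
    obtain ⟨⟨g, R⟩, -, hbig⟩ := Finset.exists_lt_card_fiber_of_mul_lt_card_of_maps_to hmaps
      (n := 2 * k) (by simpa using hcon)
    set Y := Z.filter (fun z => (row z / H, offs z) = (g, R)) with hY
    have hYm : ∀ z ∈ Y, z ∈ J ∧ k ≤ (fib z).card ∧ row z / H = g ∧ offs z = R := by
      intro z hz
      simp only [hY, hZ, Finset.mem_filter, Prod.mk.injEq] at hz
      tauto
    have hinj : Set.InjOn r Y := by
      intro x hx y hy hxy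
      by_contra hne
      obtain ⟨hx, -, hgx, -⟩ := hYm x hx
      obtain ⟨hy, -, hgy, -⟩ := hYm y hy
      have l1 := hJ.1 x hx
      have l2 := hJ.1 y hy
      rcases hJ.2 x hx y hy hne (hgx.trans hgy.symm) with h | h <;> omega
    obtain ⟨e, heY, hemono⟩ := exists_sorted_enumeration Y r hinj (2 * k) (by omega) hbig.le
    have hRcard : k ≤ R.card := by
      obtain ⟨-, h, -, rfl⟩ := hYm _ (heY 0 (by omega))
      rwa [offs_card]
    have hex : ∀ t < 2 * k, ∀ ρ ∈ R, ∃ x ∈ T, φ x = e t ∧ row x = H * g + ρ := by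
      intro t ht ρ hρ
      obtain ⟨-, -, hg, hR⟩ := hYm _ (heY t ht)
      rw [← hR] at hρ
      obtain ⟨x, hx, rfl⟩ := Finset.mem_image.1 hρ
      obtain ⟨hx, hφ⟩ := (fib_mem _ x).1 hx
      refine ⟨x, hx, hφ, ?_⟩
      have := (h1 x hx).2.1
      rw [hφ] at this
      rw [← hg, this, Nat.div_add_mod]
    apply hpat
    obtain ⟨ρ, hρR, hρmono⟩ := exists_sorted_enumeration R id (by simp) k hk hRcard
    have hX : ∀ i, ∃ x ∈ T, φ x = e (2 * α i) ∧ row x = H * g + ρ (β i) := fun i =>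
      hex _ (by have := hα i; omega) _ (hρR _ (hβ i))
    choose X hXT hXφ hXrow using hX
    refine ⟨X, hXT, ?_, ?_⟩
    · intro i j hij
      have hj := hα j
      obtain ⟨y, hyT, hyφ, hyrow⟩ := hex (2 * α i + 1) (by omega) _ (hρR _ (hβ i))
      have hlt1 := hemono (2 * α i) (2 * α i + 1) (by omega) (by omega)
      have hlt2 := hemono (2 * α i + 1) (2 * α j) (by omega) (by omega)
      have m0 := hYm _ (heY (2 * α i) (by omega))
      have m1 := hYm _ (heY (2 * α i + 1) (by omega))
      have b1 := h2 y hyT (e (2 * α i)) m0.1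
        (by have := (h1 y hyT).2.1; rw [hyφ] at this
            exact (m0.2.2.1.trans m1.2.2.1.symm).trans this)
        (by rw [hyφ]; exact hlt1)
      have m2 := hYm _ (heY (2 * α j) (by omega))
      have b2 := h2 (X j) (hXT j) (e (2 * α i + 1)) m1.1
        (by have := (h1 _ (hXT j)).2.1; rw [hXφ] at this
            exact (m1.2.2.1.trans m2.2.2.1.symm).trans this)
        (by rw [hXφ]; exact hlt2)
      have c1 := (h1 _ (hXT i)).2.2
      have c2 := (h1 y hyT).2.2
      rw [hXφ] at c1
      rw [hyφ] at c2
      have hl := hT.1 y hyT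
      have hne : X i ≠ y := by
        rintro rfl
        omega
      rcases hT.2 _ (hXT i) y hyT hne ((hXrow i).trans hyrow.symm) with h | h
      · omega
      · omega
    · intro i j hij
      have := hρmono _ _ hij (hβ j)
      simp only [id] at this
      rw [hXrow, hXrow]
      omega
  refine (card_le_of_fiber_card_le T J φ (fun x hx => (h1 x hx).1) (k - 1) H Z ?_ ?_).trans ?_
  · intro z hz hzZ
    have : ¬ k ≤ (fib z).card := fun h => hzZ (Finset.mem_filter.2 ⟨hz, h⟩)
    change (fib z).card ≤ _
    omega
  · intro z _
    have := Finset.card_le_card (offs_sub z)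
    rw [offs_card, Finset.card_range] at this
    change (fib z).card ≤ _
    omega
  · gcongr

theorem exists_column_contraction {ι : Type*} {k : ℕ} (hk : 0 < k) (α β : Fin k → ℕ)
    (hα : ∀ i, α i < k) (hβ : ∀ i, β i < k) (W n : ℕ) (hW : 0 < W) (T : Finset ι) (row l r : ι → ℕ)
    (hT : IsIntervalFamily T row l r) (hcol : ∀ x ∈ T, r x < W * n)
    (hpat : ¬ HasPattern α β T row l r) :
    ∃ J ⊆ T, IsIntervalFamily J row (fun x => l x / W) (fun x => r x / W) ∧
      T.card ≤ (k + 1) * J.card + W * (n * 2 ^ (W * W) * k) := by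
  classical
  obtain ⟨J, hJT, φ, h1, h2, hJ⟩ :=
    exists_greedy_disjoint_subfamily row (fun x => l x / W) (fun x => r x / W) T
      (fun x hx => Nat.div_le_div_right (hT.1 x hx))
  refine ⟨J, hJT, hJ, ?_⟩
  set fib : ι → Finset ι := fun z => T.filter (fun x => φ x = z) with hfib
  have fib_mem : ∀ z x, x ∈ fib z ↔ x ∈ T ∧ φ x = z := by simp [hfib]
  set Q : ι → Finset ι := fun z => (fib z).filter (fun x => l x / W = r z / W ∧ r x / W = r z / W)
    with hQ
  have Q_mem : ∀ z x, x ∈ Q z ↔ (x ∈ T ∧ φ x = z) ∧ l x / W = r z / W ∧ r x / W = r z / W := by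
    intro z x
    simp [hQ, fib_mem]
  have hsep : ∀ z, ∀ x ∈ fib z, ∀ y ∈ fib z, x ≠ y → r x < l y ∨ r y < l x := by
    intro z x hx y hy hne
    obtain ⟨hxT, rfl⟩ := (fib_mem _ _).1 hx
    obtain ⟨hyT, hφ⟩ := (fib_mem _ _).1 hy
    have e1 := (h1 x hxT).2.1
    have e2 := (h1 y hyT).2.1
    rw [hφ] at e2
    exact hT.2 x hxT y hyT hne (e1.symm.trans e2)
  have hmeet : ∀ z, ∀ x ∈ fib z, l x / W ≤ r z / W ∧ r z / W ≤ r x / W := by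
    intro z x hx
    obtain ⟨hxT, rfl⟩ := (fib_mem _ _).1 hx
    exact (h1 x hxT).2.2
  have fib_card : ∀ z, (fib z).card ≤ (Q z).card + 2 := by
    intro z
    have hA : ((fib z).filter (fun x => l x / W < r z / W)).card ≤ 1 := by
      refine Finset.card_le_one.2 fun x hx y hy => ?_
      obtain ⟨hx, hx'⟩ := Finset.mem_filter.1 hx
      obtain ⟨hy, hy'⟩ := Finset.mem_filter.1 hy
      by_contra hne
      rcases hsep z x hx y hy hne with h | h
      · have := Nat.div_le_div_right (c := W) h.le
        have := hmeet z x hx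
        omega
      · have := Nat.div_le_div_right (c := W) h.le
        have := hmeet z y hy
        omega
    have hB : ((fib z).filter (fun x => r z / W < r x / W)).card ≤ 1 := by
      refine Finset.card_le_one.2 fun x hx y hy => ?_
      obtain ⟨hx, hx'⟩ := Finset.mem_filter.1 hx
      obtain ⟨hy, hy'⟩ := Finset.mem_filter.1 hy
      by_contra hne
      rcases hsep z x hx y hy hne with h | h
      · have := Nat.div_le_div_right (c := W) h.le
        have := hmeet z y hy
        omega
      · have := Nat.div_le_div_right (c := W) h.le
        have := hmeet z x hx
        omega
    have hsub : fib z ⊆ Q z ∪ ((fib z).filter (fun x => l x / W < r z / W) ∪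
        (fib z).filter (fun x => r z / W < r x / W)) := by
      intro x hx
      have := hmeet z x hx
      simp only [hQ, Finset.mem_union, Finset.mem_filter, hx, true_and]
      omega
    have c1 := Finset.card_le_card hsub
    have c2 := Finset.card_union_le (Q z) ((fib z).filter (fun x => l x / W < r z / W) ∪
        (fib z).filter (fun x => r z / W < r x / W))
    have c3 := Finset.card_union_le ((fib z).filter (fun x => l x / W < r z / W))
        ((fib z).filter (fun x => r z / W < r x / W))
    omega
  have Q_sub : ∀ z, Q z ⊆ fib z := fun z => Finset.filter_subset _ _
  have hlinj : ∀ z, Set.InjOn l (Q z) := by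
    intro z x hx y hy hxy
    by_contra hne
    have l1 := hT.1 x ((Q_mem z x).1 hx).1.1
    have l2 := hT.1 y ((Q_mem z y).1 hy).1.1
    rcases hsep z x (Q_sub z hx) y (Q_sub z hy) hne with h | h <;> omega
  have Q_card : ∀ z, (Q z).card ≤ W := by
    intro z
    rw [← Finset.card_range W]
    refine Finset.card_le_card_of_injOn (fun x => l x % W) ?_ ?_
    · intro x _
      simpa using Nat.mod_lt _ hW
    · intro x hx y hy hxy
      refine hlinj z hx hy ?_
      have e1 := ((Q_mem z x).1 hx).2.1
      have e2 := ((Q_mem z y).1 hy).2.1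
      simp only at hxy
      rw [← Nat.div_add_mod (l x) W, ← Nat.div_add_mod (l y) W, hxy, e1, e2]
  set sig : ι → Finset (ℕ × ℕ) := fun z => (Q z).image (fun x => (l x % W, r x % W)) with hsig
  have sig_sub : ∀ z, sig z ⊆ Finset.range W ×ˢ Finset.range W := by
    intro z a ha
    obtain ⟨x, -, rfl⟩ := Finset.mem_image.1 ha
    simp [Nat.mod_lt _ hW]
  set Z := J.filter (fun z => k ≤ (Q z).card) with hZ
  have hZcard : Z.card ≤ n * 2 ^ (W * W) * k := by
    by_contra hcon
    have hmaps : ∀ z ∈ Z, (r z / W, sig z) ∈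
        Finset.range n ×ˢ (Finset.range W ×ˢ Finset.range W).powerset := by
      intro z hz
      refine Finset.mem_product.2 ⟨Finset.mem_range.2 ?_, Finset.mem_powerset.2 (sig_sub z)⟩
      exact Nat.div_lt_of_lt_mul (hcol z (hJT (Finset.mem_filter.1 hz).1))
    obtain ⟨⟨c, R⟩, -, hbig⟩ := Finset.exists_lt_card_fiber_of_mul_lt_card_of_maps_to hmaps
      (n := k) (by simpa using hcon)
    set Y := Z.filter (fun z => (r z / W, sig z) = (c, R)) with hY
    have hYm : ∀ z ∈ Y, z ∈ J ∧ k ≤ (Q z).card ∧ r z / W = c ∧ sig z = R := by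
      intro z hz
      simp only [hY, hZ, Finset.mem_filter, Prod.mk.injEq] at hz
      tauto
    have hinj : Set.InjOn row Y := by
      intro x hx y hy hxy
      by_contra hne
      obtain ⟨hx, -, hgx, -⟩ := hYm x hx
      obtain ⟨hy, -, hgy, -⟩ := hYm y hy
      have l1 := hJ.1 x hx
      have l2 := hJ.1 y hy
      simp only at l1 l2
      rcases hJ.2 x hx y hy hne hxy with h | h <;> simp only at h <;> omega
    obtain ⟨e, heY, hemono⟩ := exists_sorted_enumeration Y row hinj k hk hbig.le
    apply hpat
    have h0 := hYm _ (heY 0 hk)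
    obtain ⟨q, hqQ, hqmono⟩ := exists_sorted_enumeration (Q (e 0)) l (hlinj _) k hk h0.2.1
    have hX : ∀ i, ∃ x ∈ Q (e (β i)), l x = l (q (α i)) ∧ r x = r (q (α i)) := by
      intro i
      have hi := hYm _ (heY _ (hβ i))
      have hq := hqQ _ (hα i)
      have : (l (q (α i)) % W, r (q (α i)) % W) ∈ sig (e (β i)) := by
        rw [hi.2.2.2, ← h0.2.2.2]
        exact Finset.mem_image_of_mem _ hq
      obtain ⟨x, hx, hxe⟩ := Finset.mem_image.1 this
      obtain ⟨hxl, hxr⟩ := Prod.mk.inj hxe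
      have d1 := ((Q_mem _ _).1 hx).2
      have d2 := ((Q_mem _ _).1 hq).2
      rw [hi.2.2.1] at d1
      rw [h0.2.2.1] at d2
      refine ⟨x, hx, ?_, ?_⟩
      · rw [← Nat.div_add_mod (l x) W, ← Nat.div_add_mod (l (q (α i))) W, hxl, d1.1, d2.1]
      · rw [← Nat.div_add_mod (r x) W, ← Nat.div_add_mod (r (q (α i))) W, hxr, d1.2, d2.2]
    choose X hXQ hXl hXr using hX
    refine ⟨X, fun i => ((Q_mem _ _).1 (hXQ i)).1.1, ?_, ?_⟩
    · intro i j hij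
      rw [hXr, hXl]
      have hlt := hqmono _ _ hij (hα j)
      have hi := hqQ _ (hα i)
      have hj := hqQ _ (hα j)
      have hl := hT.1 _ ((Q_mem _ _).1 hj).1.1
      have hl' := hT.1 _ ((Q_mem _ _).1 hi).1.1
      have hne : q (α i) ≠ q (α j) := fun h => by rw [h] at hlt; omega
      rcases hsep _ _ (Q_sub _ hi) _ (Q_sub _ hj) hne with h | h <;> omega
    · intro i j hij
      have hrow : ∀ i, row (X i) = row (e (β i)) := by
        intro i
        obtain ⟨⟨hx, hφ⟩, -⟩ := (Q_mem _ _).1 (hXQ i)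
        rw [← hφ, (h1 _ hx).2.1]
      rw [hrow, hrow]
      exact hemono _ _ hij (hβ j)
  refine (card_le_of_fiber_card_le T J φ (fun x hx => (h1 x hx).1) (k + 1) W Z ?_ ?_).trans ?_
  · intro z hz hzZ
    have : ¬ k ≤ (Q z).card := fun h => hzZ (Finset.mem_filter.2 ⟨hz, h⟩)
    have := fib_card z
    change (fib z).card ≤ _
    omega
  · intro z _
    have := fib_card z
    have := Q_card z
    change (fib z).card ≤ _
    omega
  · gcongr

theorem exists_interval_family_card_le {ι : Type*} {k : ℕ} (hk : 0 < k) (α β : Fin k → ℕ)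
    (hα : ∀ i, α i < k) (hβ : ∀ i, β i < k) :
    ∃ D : ℕ, ∀ (s : ℕ) (T : Finset ι) (row l r : ι → ℕ), IsIntervalFamily T row l r →
      (∀ x ∈ T, row x < (k ^ 2 + 1) ^ s) → (∀ x ∈ T, r x < (k ^ 2 + 1) ^ s) →
      ¬ HasPattern α β T row l r → T.card ≤ D * (k ^ 2 + 1) ^ s := by
  set H := k ^ 2 + 1 with hH
  set C₁ := H * (2 ^ H * (2 * k))
  set C₂ := H * (2 ^ (H * H) * k)
  refine ⟨C₁ + (k - 1) * C₂ + 1, fun s => ?_⟩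
  induction s with
  | zero =>
    intro T row l r hT hrow hcol _
    have : T.card ≤ 1 := by
      refine Finset.card_le_one.2 fun x hx y hy => ?_
      by_contra hne
      have h1 := hrow x hx
      have h2 := hrow y hy
      have h3 := hcol x hx
      have h5 := hT.1 x hx
      have h6 := hT.1 y hy
      have h4 := hcol y hy
      simp only [pow_zero] at h1 h2 h3 h4
      rcases hT.2 x hx y hy hne (by omega) with h | h <;> omega
    simp only [pow_zero]
    omega
  | succ s ih =>
    intro T row l r hT hrow hcol hpat
    rw [pow_succ'] at hrow hcol
    have hHpos : 0 < H := by omega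
    obtain ⟨J, hJT, hJ, hTJ⟩ :=
      exists_row_contraction hk α β hα hβ H (H ^ s) hHpos T row l r hT hrow hpat
    have hpatJ : ¬ HasPattern α β J (fun x => row x / H) l r := by
      rintro ⟨X, hX, hX1, hX2⟩
      exact hpat ⟨X, fun i => hJT (hX i), hX1, fun i j h => Nat.lt_of_div_lt_div (hX2 i j h)⟩
    obtain ⟨K, hKJ, hK, hJK⟩ := exists_column_contraction hk α β hα hβ H (H ^ s) hHpos J
      (fun x => row x / H) l r hJ (fun x hx => hcol x (hJT hx)) hpatJ
    have hpatK : ¬ HasPattern α β K (fun x => row x / H) (fun x => l x / H) (fun x => r x / H) := by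
      rintro ⟨X, hX, hX1, hX2⟩
      exact hpatJ ⟨X, fun i => hKJ (hX i), fun i j h => Nat.lt_of_div_lt_div (hX1 i j h), hX2⟩
    have hKcard := ih K _ _ _ hK
      (fun x hx => Nat.div_lt_of_lt_mul (hrow x (hJT (hKJ hx))))
      (fun x hx => Nat.div_lt_of_lt_mul (hcol x (hJT (hKJ hx)))) hpatK
    obtain ⟨k, rfl⟩ : ∃ j, k = j + 1 := ⟨k - 1, by omega⟩
    simp only [Nat.add_sub_cancel] at *
    set D := C₁ + k * C₂ + 1
    have e1 : H * (H ^ s * 2 ^ H * (2 * (k + 1))) = C₁ * H ^ s := by simp only [C₁]; ring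
    have e2 : H * (H ^ s * 2 ^ (H * H) * (k + 1)) = C₂ * H ^ s := by simp only [C₂]; ring
    rw [e1] at hTJ
    rw [e2] at hJK
    calc T.card ≤ k * ((k + 1 + 1) * (D * H ^ s) + C₂ * H ^ s) + C₁ * H ^ s := by
          refine hTJ.trans ?_
          gcongr
          refine hJK.trans ?_
          gcongr
      _ = (k * (k + 2) * D + (k * C₂ + C₁)) * H ^ s := by ring
      _ ≤ (k * (k + 2) * D + D) * H ^ s := by
          gcongr
          simp only [D]
          omega
      _ = (k * (k + 2) + 1) * D * H ^ s := by ring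
      _ ≤ H * D * H ^ s := by
          gcongr
          rw [hH]
          nlinarith
      _ = D * H ^ (s + 1) := by ring

/-- A sequence with values at most `M` has disjoint blocks of consecutive terms, each of sum at
least `M`, whose number is bounded below linearly in the total sum. -/
theorem exists_blocks_of_sum_ge (g : ℕ → ℝ) (M : ℝ) (hM : 0 ≤ M) (hg : ∀ c, g c ≤ M) (n : ℕ) :
    ∃ F : Finset (ℕ × ℕ), (∀ x ∈ F, x.1 ≤ x.2 ∧ x.2 < n ∧
        M ≤ ∑ c ∈ Finset.Ico x.1 (x.2 + 1), g c) ∧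
      (∀ x ∈ F, ∀ y ∈ F, x ≠ y → x.2 < y.1 ∨ y.2 < x.1) ∧
      ∑ c ∈ Finset.range n, g c ≤ 2 * M * F.card + M := by
  classical
  suffices h : ∃ F : Finset (ℕ × ℕ), ∃ t ≤ n,
      (∀ x ∈ F, x.1 ≤ x.2 ∧ x.2 < t ∧ M ≤ ∑ c ∈ Finset.Ico x.1 (x.2 + 1), g c) ∧
      (∀ x ∈ F, ∀ y ∈ F, x ≠ y → x.2 < y.1 ∨ y.2 < x.1) ∧
      ∑ c ∈ Finset.Ico t n, g c ≤ M ∧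
      ∑ c ∈ Finset.range n, g c ≤ 2 * M * F.card + ∑ c ∈ Finset.Ico t n, g c by
    obtain ⟨F, t, ht, h1, h2, h3, h4⟩ := h
    exact ⟨F, fun x hx => ⟨(h1 x hx).1, by have := (h1 x hx).2.1; omega, (h1 x hx).2.2⟩, h2,
      by linarith⟩
  induction n with
  | zero => exact ⟨∅, 0, le_rfl, by simp, by simp, by simpa using hM, by simp⟩
  | succ n ih =>
    obtain ⟨F, t, ht, h1, h2, h3, h4⟩ := ih
    have hsum : ∑ c ∈ Finset.Ico t (n + 1), g c = ∑ c ∈ Finset.Ico t n, g c + g n :=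
      Finset.sum_Ico_succ_top ht g
    by_cases hcase : ∑ c ∈ Finset.Ico t (n + 1), g c ≤ M
    · refine ⟨F, t, by omega, h1, h2, hcase, ?_⟩
      rw [Finset.sum_range_succ, hsum]
      linarith
    · have hnew : (t, n) ∉ F := fun h => by
        have := (h1 _ h).2.1
        simp only at this
        omega
      refine ⟨insert (t, n) F, n + 1, le_rfl, ?_, ?_, by simpa using hM, ?_⟩
      · intro x hx
        rcases Finset.mem_insert.1 hx with rfl | hx
        · exact ⟨ht, by simp, (not_le.1 hcase).le⟩
        · exact ⟨(h1 x hx).1, by have := (h1 x hx).2.1; omega, (h1 x hx).2.2⟩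
      · intro x hx y hy hxy
        rcases Finset.mem_insert.1 hx with rfl | hxF <;>
          rcases Finset.mem_insert.1 hy with rfl | hyF
        · exact absurd rfl hxy
        · exact Or.inr (h1 y hyF).2.1
        · exact Or.inl (h1 x hxF).2.1
        · exact h2 x hxF y hyF hxy
      · rw [Finset.sum_range_succ, Finset.card_insert_of_notMem hnew]
        have := hg n
        push_cast
        simp only [Finset.Ico_self, Finset.sum_empty]
        linarith

/-- A measurable set of measure larger than `B - A` admits an expanding map from `[A, B]`. -/
theorem exists_expanding_map (U : Set ℝ) (hU : MeasurableSet U) (A B : ℝ) (hAB : A ≤ B)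
    (hvol : ENNReal.ofReal (B - A) < volume U) :
    ∃ φ : ℝ → ℝ, (∀ x ∈ Set.Icc A B, φ x ∈ U) ∧
      ∀ x ∈ Set.Icc A B, ∀ x' ∈ Set.Icc A B, x' < x → x - x' ≤ φ x - φ x' := by
  obtain ⟨K, hKU, hK, hKvol⟩ := hU.exists_lt_isCompact hvol
  have hfin : volume K ≠ ⊤ := hK.measure_lt_top.ne
  have hKreal : B - A < volume.real K := by
    rw [Measure.real, ← ENNReal.ofReal_lt_iff_lt_toReal (by linarith) hfin]
    exact hKvol
  set G : ℝ → ℝ := fun t => volume.real (K ∩ Set.Iic t) with hG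
  have hfin' : ∀ s : Set ℝ, volume (K ∩ s) ≠ ⊤ := fun s =>
    ((measure_mono Set.inter_subset_left).trans_lt hK.measure_lt_top).ne
  have hmono : Monotone G := fun s t hst =>
    measureReal_mono (Set.inter_subset_inter_right _ (Set.Iic_subset_Iic.2 hst)) (hfin' _)
  have hadd : ∀ s t, s ≤ t → G t = G s + volume.real (K ∩ Set.Ioc s t) := by
    intro s t hst
    have : K ∩ Set.Iic t = (K ∩ Set.Iic s) ∪ (K ∩ Set.Ioc s t) := by
      rw [← Set.inter_union_distrib_left, Set.Iic_union_Ioc_eq_Iic hst]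
    simp only [hG]
    rw [this, measureReal_union _ (hK.measurableSet.inter measurableSet_Ioc) (hfin' _) (hfin' _)]
    refine Set.disjoint_left.2 fun x hx hx' => ?_
    exact absurd hx'.2.1 (not_lt.2 hx.2)
  have hlip : ∀ s t, s ≤ t → G t ≤ G s + (t - s) := by
    intro s t hst
    rw [hadd s t hst]
    have : volume.real (K ∩ Set.Ioc s t) ≤ volume.real (Set.Ioc s t) :=
      measureReal_mono Set.inter_subset_right (by simp)
    rw [Real.volume_real_Ioc_of_le hst] at this
    linarith
  have hcont : Continuous G := by
    have : LipschitzWith 1 G := LipschitzWith.of_le_add fun s t => by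
      rcases le_total s t with h | h
      · have := hmono h
        have := dist_nonneg (x := s) (y := t)
        linarith
      · have := hlip t s h
        rw [Real.dist_eq, abs_of_nonneg (by linarith)]
        exact this
    exact this.continuous
  obtain ⟨R, hR⟩ := hK.isBounded.subset_closedBall 0
  have hKR : ∀ x ∈ K, -R ≤ x ∧ x ≤ R := fun x hx => by
    have := hR hx
    rw [Metric.mem_closedBall, Real.dist_eq, sub_zero] at this
    exact abs_le.1 this
  have hlow : G (-R - 1) = 0 := by
    have : K ∩ Set.Iic (-R - 1) = ∅ := Set.eq_empty_of_forall_notMem fun x hx => by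
      have h1 := (hKR x hx.1).1
      have h2 : x ≤ -R - 1 := hx.2
      linarith
    simp [hG, this]
  have hhigh : G R = volume.real K := by
    have : K ∩ Set.Iic R = K := Set.inter_eq_left.2 fun x hx => (hKR x hx).2
    simp [hG, this]
  have hle : -R - 1 ≤ R := by
    by_contra hcon
    have := hmono (not_le.1 hcon).le
    rw [hlow, hhigh] at this
    linarith
  have key : ∀ c : ℝ, 0 < c → c ≤ volume.real K → ∃ t ∈ K, G t = c := by
    intro c hc0 hc1
    obtain ⟨t, -, ht⟩ := intermediate_value_Icc hle hcont.continuousOn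
      (show c ∈ Set.Icc (G (-R - 1)) (G R) by rw [hlow, hhigh]; exact ⟨hc0.le, hc1⟩)
    have hne : (K ∩ Set.Iic t).Nonempty := by
      by_contra hcon
      rw [Set.not_nonempty_iff_eq_empty] at hcon
      simp only [hG, hcon, measureReal_empty] at ht
      linarith
    obtain ⟨u, hu, hmax⟩ := (hK.inter_right isClosed_Iic).exists_isGreatest hne
    refine ⟨u, hu.1, ?_⟩
    have hempty : K ∩ Set.Ioc u t = ∅ := Set.eq_empty_of_forall_notMem fun x hx =>
      absurd (hmax ⟨hx.1, hx.2.2⟩) (not_le.2 hx.2.1)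
    have := hadd u t hu.2
    rw [hempty, measureReal_empty, add_zero] at this
    rw [← this, ht]
  choose! φ hφK hφG using key
  refine ⟨fun x => φ (x - B + volume.real K), fun x hx => hKU (hφK _ ?_ ?_), ?_⟩
  · linarith [hx.1]
  · linarith [hx.2]
  · intro x hx x' hx' hlt
    have e1 := hφG (x - B + volume.real K) (by linarith [hx.1]) (by linarith [hx.2])
    have e2 := hφG (x' - B + volume.real K) (by linarith [hx'.1]) (by linarith [hx'.2])
    have hle : φ (x' - B + volume.real K) ≤ φ (x - B + volume.real K) := by
      by_contra hcon
      have := hmono (not_le.1 hcon).le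
      linarith
    have := hlip _ _ hle
    linarith

theorem exists_lt_rank {k : ℕ} (f : Fin k → ℝ) :
    ∃ ρ : Fin k → ℕ, (∀ i, ρ i < k) ∧ ∀ i j, f i < f j → ρ i < ρ j := by
  classical
  refine ⟨fun i => (Finset.univ.filter (fun j => f j < f i)).card, fun i => ?_, fun i j hij => ?_⟩
  · have := Finset.card_lt_card
      (Finset.filter_ssubset (p := fun j => f j < f i).2 ⟨i, Finset.mem_univ i, lt_irrefl _⟩)
    simpa using this
  · refine Finset.card_lt_card ((Finset.ssubset_iff_of_subset fun x hx => ?_).2 ⟨i, ?_, ?_⟩)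
    · simp only [Finset.mem_filter, Finset.mem_univ, true_and] at hx ⊢
      exact hx.trans hij
    · simpa using hij
    · simp

theorem pContains_of_large_slices {k : ℕ} (a b y : Fin k → ℝ) (hab : ∀ i, a i < b i)
    (hdisj : ∀ i j, i ≠ j → Disjoint (Set.Icc (a i) (b i)) (Set.Icc (a j) (b j)))
    (hy : Function.Injective y) (A B M : ℝ) (hA : ∀ i, A ≤ a i) (hB : ∀ i, b i ≤ B)
    (hM : ∀ i j, y i - y j ≤ M) (S : Set (ℝ × ℝ)) (hS : IsOpen S) (h u v : Fin k → ℝ)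
    (huv : ∀ i j, a i < a j → v i ≤ u j) (hh : ∀ i j, y i < y j → h i + M ≤ h j)
    (hvol : ∀ i, ENNReal.ofReal (B - A) < volume ({x | (x, h i) ∈ S} ∩ Set.Ico (u i) (v i))) :
    PContains S (⋃ i, Set.Icc (a i) (b i) ×ˢ ({y i} : Set ℝ)) := by
  classical
  rcases isEmpty_or_nonempty (Fin k) with hempty | ⟨⟨i₀⟩⟩
  · exact ⟨id, id, by simp, by simp, by simp⟩
  have hAB : A ≤ B := (hA i₀).trans ((hab i₀).le.trans (hB i₀))
  have hmeas : ∀ i, MeasurableSet ({x | (x, h i) ∈ S} ∩ Set.Ico (u i) (v i)) := fun i =>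
    (hS.preimage (by fun_prop : Continuous fun x : ℝ => (x, h i))).measurableSet.inter
      measurableSet_Ico
  choose φ hφ hφmono using fun i => exists_expanding_map _ (hmeas i) A B hAB (hvol i)
  have huniq : ∀ i j x, x ∈ Set.Icc (a i) (b i) → x ∈ Set.Icc (a j) (b j) → i = j := by
    intro i j x hi hj
    by_contra hne
    exact Set.disjoint_left.1 (hdisj i j hne) hi hj
  set fX : ℝ → ℝ := fun x => if hx : ∃ i, x ∈ Set.Icc (a i) (b i) then φ hx.choose x else 0
    with hfX
  have hfX_eq : ∀ i x, x ∈ Set.Icc (a i) (b i) → fX x = φ i x := by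
    intro i x hx
    have hex : ∃ i, x ∈ Set.Icc (a i) (b i) := ⟨i, hx⟩
    simp only [hfX, dif_pos hex]
    rw [huniq _ _ x hex.choose_spec hx]
  have hIcc : ∀ i x, x ∈ Set.Icc (a i) (b i) → x ∈ Set.Icc A B := fun i x hx =>
    ⟨(hA i).trans hx.1, hx.2.trans (hB i)⟩
  have hlow : ∀ i x, x ∈ Set.Icc A B → u i + (x - A) ≤ φ i x := by
    intro i x hx
    have h1 := (hφ i A ⟨le_rfl, hAB⟩).2.1
    rcases hx.1.eq_or_lt with rfl | hlt
    · linarith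
    · have := hφmono i x hx A ⟨le_rfl, hAB⟩ hlt
      linarith
  have hupp : ∀ i x, x ∈ Set.Icc A B → φ i x ≤ v i - (B - x) := by
    intro i x hx
    have h1 := (hφ i B ⟨hAB, le_rfl⟩).2.2
    rcases hx.2.eq_or_lt with rfl | hlt
    · linarith
    · have := hφmono i B ⟨hAB, le_rfl⟩ x hx hlt
      linarith
  refine ⟨fX, Function.extend y h 0, ?_, ?_, ?_⟩
  · rintro x₀ x₁ ⟨y₀, hP₀⟩ ⟨y₁, hP₁⟩ hlt
    obtain ⟨i, hi, -⟩ := Set.mem_iUnion.1 hP₀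
    obtain ⟨j, hj, -⟩ := Set.mem_iUnion.1 hP₁
    simp only at hi hj
    rw [hfX_eq i x₀ hi, hfX_eq j x₁ hj]
    by_cases hij : i = j
    · subst hij
      exact hφmono i x₀ (hIcc i x₀ hi) x₁ (hIcc i x₁ hj) hlt
    · have haij : a j < a i := by
        by_contra hcon
        have hmem : a j ∈ Set.Icc (a i) (b i) :=
          ⟨not_lt.1 hcon, hj.1.trans (hlt.le.trans hi.2)⟩
        exact hij (huniq i j _ hmem ⟨le_rfl, (hab j).le⟩)
      have h1 := hlow i x₀ (hIcc i x₀ hi)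
      have h2 := hupp j x₁ (hIcc j x₁ hj)
      have h3 := huv j i haij
      linarith
  · rintro y₀ y₁ ⟨x₀, hP₀⟩ ⟨x₁, hP₁⟩ hlt
    obtain ⟨i, -, hi⟩ := Set.mem_iUnion.1 hP₀
    obtain ⟨j, -, hj⟩ := Set.mem_iUnion.1 hP₁
    obtain rfl : y₀ = y i := hi
    obtain rfl : y₁ = y j := hj
    rw [hy.extend_apply, hy.extend_apply]
    have h1 := hh j i hlt
    have h2 := hM i j
    linarith
  · rintro ⟨x, t⟩ hP
    obtain ⟨i, hi, ht⟩ := Set.mem_iUnion.1 hP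
    obtain rfl : t = y i := ht
    simp only at hi ⊢
    rw [hy.extend_apply, hfX_eq i x hi]
    exact (hφ i x (hIcc i x hi)).1

theorem sum_measureReal_inter_Ico (U : Set ℝ) (hU : MeasurableSet U) (M : ℝ) (hM : 0 ≤ M)
    (p q : ℕ) (hpq : p ≤ q) :
    ∑ c ∈ Finset.Ico p q, volume.real (U ∩ Set.Ico (c * M) ((c + 1) * M)) =
      volume.real (U ∩ Set.Ico (p * M) (q * M)) := by
  induction q, hpq using Nat.le_induction with
  | base => simp
  | succ q hpq ih =>
    have hfin : ∀ s t : ℝ, volume (U ∩ Set.Ico s t) ≠ ⊤ := fun s t =>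
      ((measure_mono Set.inter_subset_right).trans_lt measure_Ico_lt_top).ne
    rw [Finset.sum_Ico_succ_top hpq, ih,
      ← measureReal_union _ (hU.inter measurableSet_Ico) (hfin _ _) (hfin _ _),
      ← Set.inter_union_distrib_left, Set.Ico_union_Ico_eq_Ico]
    · push_cast
      rfl
    · exact mul_le_mul_of_nonneg_right (by exact_mod_cast hpq) hM
    · exact mul_le_mul_of_nonneg_right (by linarith) hM
    · refine Set.disjoint_left.2 fun x hx hx' => ?_
      exact absurd hx'.2.1 (not_le.2 hx.2.2)

theorem lintegral_Ico_le_lintegral_sum (f : ℝ → ℝ≥0∞) (hf : Measurable f) (M : ℝ) (hM : 0 ≤ M)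
    (m : ℕ) :
    ∫⁻ t in Set.Ico 0 (m * M), f t ≤
      ∫⁻ t in Set.Ico 0 M, ∑ j ∈ Finset.range m, f (t + j * M) := by
  rw [lintegral_finsetSum _ fun j _ => (by fun_prop : Measurable fun t : ℝ => f (t + (j : ℕ) * M))]
  induction m with
  | zero => simp
  | succ m ih =>
    have hsplit : Set.Ico (0 : ℝ) ((m + 1 : ℕ) * M) =
        Set.Ico 0 (m * M) ∪ Set.Ico (m * M) ((m + 1 : ℕ) * M) := by
      rw [Set.Ico_union_Ico_eq_Ico (by positivity)]
      push_cast
      linarith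
    have hshift : ∫⁻ t in Set.Ico (m * M) ((m + 1 : ℕ) * M), f t =
        ∫⁻ t in Set.Ico 0 M, f (t + m * M) := by
      have := (measurePreserving_add_right (volume : Measure ℝ) (m * M)).setLIntegral_comp_preimage
        (measurableSet_Ico (a := m * M) (b := (m + 1 : ℕ) * M)) hf
      rw [← this]
      congr 2
      ext t
      simp only [Set.mem_preimage, Set.mem_Ico]
      push_cast
      constructor <;> rintro ⟨h1, h2⟩ <;> constructor <;> linarith
    rw [hsplit, Finset.sum_range_succ, ← hshift]
    exact (lintegral_union_le _ _ _).trans (by gcongr)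

theorem exists_pow_between (H m : ℕ) (hH : 2 ≤ H) (hm : 0 < m) :
    ∃ s, m ≤ H ^ s ∧ H ^ s ≤ H * m := by
  classical
  have hex : ∃ s, m ≤ H ^ s := ⟨m, (Nat.lt_pow_self (by omega)).le⟩
  refine ⟨Nat.find hex, Nat.find_spec hex, ?_⟩
  rcases hs : Nat.find hex with _ | s
  · simp only [pow_zero]
    nlinarith
  · have := Nat.find_min hex (m := s) (by omega)
    rw [pow_succ']
    exact Nat.mul_le_mul_left _ (by omega)

theorem px_disjoint_horizontal_segments (k : ℕ) (hk : 1 ≤ k)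
    (a b y : Fin k → ℝ) (hab : ∀ i, a i < b i)
    (hdisj : ∀ i j, i ≠ j → Disjoint (Set.Icc (a i) (b i)) (Set.Icc (a j) (b j)))
    (hy : Function.Injective y) :
    ∃ C : ℝ, 0 < C ∧ ∀ n : ℝ, 1 ≤ n →
      px n (⋃ i, Set.Icc (a i) (b i) ×ˢ ({y i} : Set ℝ)) ≤ ENNReal.ofReal (C * n) := by
  classical
  obtain ⟨A, hA⟩ := (Set.finite_range a).bddBelow
  obtain ⟨B, hB⟩ := (Set.finite_range b).bddAbove
  obtain ⟨Y₁, hY₁⟩ := (Set.finite_range y).bddBelow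
  obtain ⟨Y₂, hY₂⟩ := (Set.finite_range y).bddAbove
  replace hA : ∀ i, A ≤ a i := fun i => hA ⟨i, rfl⟩
  replace hB : ∀ i, b i ≤ B := fun i => hB ⟨i, rfl⟩
  replace hY₁ : ∀ i, Y₁ ≤ y i := fun i => hY₁ ⟨i, rfl⟩
  replace hY₂ : ∀ i, y i ≤ Y₂ := fun i => hY₂ ⟨i, rfl⟩
  have i₀ : Fin k := ⟨0, hk⟩
  have hABle : A < B := (hA i₀).trans_lt ((hab i₀).trans_le (hB i₀))
  have hYle : Y₁ ≤ Y₂ := (hY₁ i₀).trans (hY₂ i₀)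
  obtain ⟨M, hM1, hMx, hMy⟩ : ∃ M : ℝ, 1 ≤ M ∧ B - A < M ∧ ∀ i j, y i - y j ≤ M :=
    ⟨B - A + (Y₂ - Y₁) + 1, by linarith, by linarith, fun i j => by
      linarith [hY₂ i, hY₁ j]⟩
  obtain ⟨α, hαk, hα⟩ := exists_lt_rank a
  obtain ⟨β, hβk, hβ⟩ := exists_lt_rank y
  obtain ⟨D, hD⟩ := exists_interval_family_card_le (ι := Σ _ : ℕ, ℕ × ℕ) hk α β hαk hβk
  set H := k ^ 2 + 1 with hH
  have hM0 : 0 < M := by linarith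
  refine ⟨M * (M * (2 * D * H + 1) * 2), by positivity, fun n hn => ?_⟩
  refine sSup_le ?_
  rintro _ ⟨S, hS, hSn, hSP, rfl⟩
  set m := ⌊n / M⌋₊ + 1 with hm
  have hnm : n < m * M := by
    rw [← div_lt_iff₀ hM0]
    exact_mod_cast Nat.lt_floor_add_one (n / M)
  have hmn : (m : ℝ) ≤ 2 * n := by
    have h1 := Nat.floor_le (div_nonneg (by linarith : (0 : ℝ) ≤ n) hM0.le)
    have h2 : n / M ≤ n := div_le_self (by linarith) hM1
    push_cast [hm]
    linarith
  obtain ⟨s, hms, hsm⟩ := exists_pow_between H m (by have := Nat.one_le_pow 2 k hk; omega)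
    (by omega)
  have hslice_open : ∀ h : ℝ, IsOpen {x | (x, h) ∈ S} := fun h =>
    hS.preimage (by fun_prop : Continuous fun x : ℝ => (x, h))
  have hslice_eq : ∀ h : ℝ,
      {x | (x, h) ∈ S} = {x | (x, h) ∈ S} ∩ Set.Ico ((0 : ℕ) * M) (m * M) := by
    intro h
    refine (Set.inter_eq_left.2 fun x hx => ?_).symm
    have := hSn hx
    exact ⟨by simpa using this.1.1, this.2.1.trans_lt hnm⟩
  have hslice_fin : ∀ h : ℝ, volume {x | (x, h) ∈ S} ≠ ⊤ := fun h => by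
    rw [hslice_eq]
    exact ((measure_mono Set.inter_subset_right).trans_lt measure_Ico_lt_top).ne
  have hrows : ∀ t : ℝ, ∑ j ∈ Finset.range m, volume.real {x | (x, t + j * M) ∈ S} ≤
      M * (2 * D * H + 1) * m := by
    intro t
    set g : ℕ → ℕ → ℝ := fun j c =>
      volume.real ({x | (x, t + j * M) ∈ S} ∩ Set.Ico (c * M) ((c + 1) * M)) with hg
    have hgM : ∀ j c, g j c ≤ M := fun j c => by
      have : g j c ≤ volume.real (Set.Ico (c * M) ((c + 1) * M)) :=
        measureReal_mono Set.inter_subset_right (by simp)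
      rw [Real.volume_real_Ico_of_le (by linarith)] at this
      linarith
    have hgsum : ∀ j p q : ℕ, p ≤ q → ∑ c ∈ Finset.Ico p q, g j c =
        volume.real ({x | (x, t + j * M) ∈ S} ∩ Set.Ico (p * M) (q * M)) := fun j p q hpq =>
      sum_measureReal_inter_Ico _ (hslice_open _).measurableSet M hM0.le p q hpq
    choose F hF1 hF2 hF3 using fun j => exists_blocks_of_sum_ge (g j) M hM0.le (hgM j) m
    set T : Finset (Σ _ : ℕ, ℕ × ℕ) := (Finset.range m).sigma F with hTdef
    have hTcard : T.card ≤ D * H ^ s := by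
      refine hD s T (fun x => x.1) (fun x => x.2.1) (fun x => x.2.2) ⟨?_, ?_⟩ ?_ ?_ ?_
      · intro x hx
        exact (hF1 _ _ (Finset.mem_sigma.1 hx).2).1
      · rintro ⟨i, x⟩ hx ⟨j, z⟩ hz hne hij
        obtain rfl : i = j := hij
        exact hF2 i x (Finset.mem_sigma.1 hx).2 z (Finset.mem_sigma.1 hz).2
          fun h => hne (by rw [h])
      · intro x hx
        exact (Finset.mem_range.1 (Finset.mem_sigma.1 hx).1).trans_le hms
      · intro x hx
        exact (hF1 _ _ (Finset.mem_sigma.1 hx).2).2.1.trans_le hms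
      · rintro ⟨X, hX, hX1, hX2⟩
        refine hSP (pContains_of_large_slices a b y hab hdisj hy A B M hA hB hMy S hS
          (fun i => t + (X i).1 * M) (fun i => (X i).2.1 * M)
          (fun i => ((X i).2.2 + 1 : ℕ) * M) ?_ ?_ ?_)
        · intro i j hij
          have := hX1 i j (hα i j hij)
          exact mul_le_mul_of_nonneg_right (by exact_mod_cast this) hM0.le
        · intro i j hij
          have : ((X i).1 : ℝ) + 1 ≤ (X j).1 := by exact_mod_cast hX2 i j (hβ i j hij)
          nlinarith
        · intro i
          have hXi := hF1 _ _ (Finset.mem_sigma.1 (hX i)).2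
          rw [hgsum _ _ _ (by omega)] at hXi
          refine (ENNReal.ofReal_lt_iff_lt_toReal (by linarith) ?_).2 (hMx.trans_le hXi.2.2)
          exact ((measure_mono Set.inter_subset_right).trans_lt measure_Ico_lt_top).ne
    have hcard : (T.card : ℝ) = ∑ j ∈ Finset.range m, ((F j).card : ℝ) := by
      rw [hTdef, Finset.card_sigma]
      push_cast
      rfl
    have hTreal : (T.card : ℝ) ≤ D * (H * m) := by
      exact_mod_cast hTcard.trans (Nat.mul_le_mul_left D hsm)
    calc ∑ j ∈ Finset.range m, volume.real {x | (x, t + j * M) ∈ S}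
        ≤ ∑ j ∈ Finset.range m, (2 * M * (F j).card + M) := by
          refine Finset.sum_le_sum fun j _ => ?_
          rw [hslice_eq, ← hgsum j 0 m (Nat.zero_le _), ← Finset.range_eq_Ico]
          exact hF3 j
      _ = 2 * M * T.card + m * M := by
          rw [Finset.sum_add_distrib, ← Finset.mul_sum, ← hcard]
          simp
      _ ≤ 2 * M * (D * (H * m)) + m * M := by gcongr
      _ = _ := by ring
  have hrows' : ∀ t : ℝ, ∑ j ∈ Finset.range m, volume {x | (x, t + j * M) ∈ S} ≤
      ENNReal.ofReal (M * (2 * D * H + 1) * m) := by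
    intro t
    refine le_trans (le_of_eq ?_) (ENNReal.ofReal_le_ofReal (hrows t))
    rw [ENNReal.ofReal_sum_of_nonneg fun _ _ => measureReal_nonneg]
    exact Finset.sum_congr rfl fun j _ => (ENNReal.ofReal_toReal (hslice_fin _)).symm
  have hmeas : Measurable fun h : ℝ => volume {x : ℝ | (x, h) ∈ S} :=
    measurable_measure_prodMk_right hS.measurableSet
  calc volume S = ∫⁻ h : ℝ, volume {x : ℝ | (x, h) ∈ S} := by
        rw [Measure.volume_eq_prod, Measure.prod_apply_symm hS.measurableSet]
        rfl
    _ = ∫⁻ h in Set.Ico 0 (m * M), volume {x : ℝ | (x, h) ∈ S} := by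
        refine (setLIntegral_eq_of_support_subset ?_).symm
        intro h hh
        by_contra hcon
        refine hh ?_
        have : {x : ℝ | (x, h) ∈ S} = ∅ := Set.eq_empty_of_forall_notMem fun x hx =>
          hcon ⟨(hSn hx).1.2, (hSn hx).2.2.trans_lt hnm⟩
        simp [this]
    _ ≤ ∫⁻ t in Set.Ico 0 M, ∑ j ∈ Finset.range m, volume {x : ℝ | (x, t + j * M) ∈ S} :=
        lintegral_Ico_le_lintegral_sum _ hmeas M hM0.le m
    _ ≤ ∫⁻ _ in Set.Ico 0 M, ENNReal.ofReal (M * (2 * D * H + 1) * m) :=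
        lintegral_mono hrows'
    _ = ENNReal.ofReal (M * (M * (2 * D * H + 1) * m)) := by
        rw [setLIntegral_const, Real.volume_Ico, sub_zero, mul_comm,
          ← ENNReal.ofReal_mul hM0.le]
    _ ≤ ENNReal.ofReal (M * (M * (2 * D * H + 1) * 2) * n) := by
        refine ENNReal.ofReal_le_ofReal ?_
        calc M * (M * (2 * D * H + 1) * m) ≤ M * (M * (2 * D * H + 1) * (2 * n)) := by gcongr
          _ = _ := by ring
end

section
/- Let d ≥ 1 and t ≥ 2 be integers, let c > 0 be real, and let P ⊆ ℝ^d. Define Q_{P,t,c} ⊆ ℝ^{d+1} by Q_{P,t,c} = {(x₁, …, x_d, j·c) : (x₁, …, x_d) ∈ P and j ∈ {1, 2, …, t}}. Then for every real n > 0, px(n, Q_{P,t,c}, d+1) ≤ c·t·n^d + t · px(n, P, d)^{1/t} · n^{d+1 − d/t}. -/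
open MeasureTheory Set
open scoped ENNReal

/-- `S` contains `P` (for subsets of `ℝ^d`). -/
def DContains {d : ℕ} (S P : Set (Fin d → ℝ)) : Prop :=
  ∃ f : Fin d → ℝ → ℝ,
    (∀ i : Fin d, ∀ x x' : ℝ, (∃ p ∈ P, p i = x) → (∃ p ∈ P, p i = x') → x' < x →
      x - x' ≤ f i x - f i x') ∧
    ∀ p ∈ P, (fun i => f i (p i)) ∈ S

/-- `pxD d n P`: supremum of the `d`-dimensional Lebesgue measure of open `P`-free
subsets of `[0,n]^d`. -/
noncomputable def pxD (d : ℕ) (n : ℝ) (P : Set (Fin d → ℝ)) : ℝ≥0∞ :=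
  sSup {m : ℝ≥0∞ | ∃ S : Set (Fin d → ℝ), IsOpen S ∧
    S ⊆ Set.Icc (fun _ => 0) (fun _ => n) ∧ ¬ DContains S P ∧ m = volume S}

/-- The `t`-tuples in `A` whose consecutive entries increase by at least `c`. -/
def separatedTuples (t : ℕ) (c : ℝ) (A : Set ℝ) : Set (Fin t → ℝ) :=
  {y | (∀ j, y j ∈ A) ∧ ∀ j j' : Fin t, (j : ℕ) + 1 = j' → y j + c ≤ y j'}

lemma exists_volume_real_inter_Iic_eq {A : Set ℝ} {n : ℝ} (hn : 0 < n)
    (hA : A ⊆ Icc 0 n) {a : ℝ} (ha : a ∈ Icc 0 (volume.real A)) :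
    ∃ w, volume.real (A ∩ Iic w) = a := by
  have hfin : volume A ≠ ∞ :=
    ne_top_of_le_ne_top (by simp [Real.volume_Icc]) (measure_mono hA)
  have hfin' (z : ℝ) : volume (A ∩ Iic z) ≠ ∞ :=
    ne_top_of_le_ne_top hfin (measure_mono inter_subset_left)
  have hmono : Monotone fun z => volume.real (A ∩ Iic z) := fun x y hxy =>
    measureReal_mono (inter_subset_inter_right _ (Iic_subset_Iic.2 hxy)) (hfin' y)
  have hstep (x y : ℝ) (hxy : x ≤ y) :
      volume.real (A ∩ Iic y) ≤ volume.real (A ∩ Iic x) + (y - x) := by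
    have hsub : A ∩ Iic y ⊆ (A ∩ Iic x) ∪ Ioc x y := by
      rintro z ⟨hzA, hz⟩
      rcases le_or_gt z x with h | h
      · exact Or.inl ⟨hzA, h⟩
      · exact Or.inr ⟨h, hz⟩
    calc volume.real (A ∩ Iic y) ≤ volume.real ((A ∩ Iic x) ∪ Ioc x y) :=
          measureReal_mono hsub (measure_union_ne_top (hfin' x) (by simp [Real.volume_Ioc]))
      _ ≤ volume.real (A ∩ Iic x) + volume.real (Ioc x y) := measureReal_union_le _ _
      _ = _ := by rw [Real.volume_real_Ioc_of_le hxy]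
  have hcont : Continuous fun z => volume.real (A ∩ Iic z) := by
    refine (LipschitzWith.of_le_add fun x y => ?_ : LipschitzWith 1 _).continuous
    rcases le_total x y with h | h
    · exact (hmono h).trans (le_add_of_nonneg_right dist_nonneg)
    · rw [Real.dist_eq, abs_of_nonneg (sub_nonneg.2 h)]
      exact hstep y x h
  have h0 : A ∩ Iic (-1) = ∅ := by
    ext z
    simp only [mem_inter_iff, mem_Iic, mem_empty_iff_false, iff_false, not_and, not_le]
    intro hz
    linarith [(hA hz).1]
  have h1 : A ∩ Iic n = A := inter_eq_left.2 fun z hz => (hA hz).2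
  have := intermediate_value_Icc (show (-1 : ℝ) ≤ n by linarith) hcont.continuousOn
  simp only [h0, h1, measureReal_empty] at this
  obtain ⟨w, -, hw⟩ := this ha
  exact ⟨w, hw⟩

lemma pow_le_volume_separatedTuples {t : ℕ} (ht : 0 < t) {c n : ℝ} (hc : 0 < c) (hn : 0 < n)
    {A : Set ℝ} (hA : A ⊆ Icc 0 n) :
    (volume A / t - ENNReal.ofReal c) ^ t ≤ volume (separatedTuples t c A) := by
  have hfin : volume A ≠ ∞ :=
    ne_top_of_le_ne_top (by simp [Real.volume_Icc]) (measure_mono hA)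
  have ht' : (0 : ℝ) < t := by exact_mod_cast ht
  have hex (k : ℕ) : ∃ w, k ≤ t → volume.real (A ∩ Iic w) = k * (volume.real A / t) := by
    by_cases hk : k ≤ t
    · obtain ⟨w, hw⟩ := exists_volume_real_inter_Iic_eq hn hA
        (a := k * (volume.real A / t)) ⟨by positivity, by
          have hk' : (k : ℝ) ≤ t := by exact_mod_cast hk
          calc (k : ℝ) * (volume.real A / t) ≤ t * (volume.real A / t) := by gcongr
            _ = volume.real A := by field_simp⟩
      exact ⟨w, fun _ => hw⟩
    · exact ⟨0, fun h => absurd h hk⟩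
  choose w hw using hex
  let B : Fin t → Set ℝ := fun j => A ∩ Ioc (w j) (w (j + 1) - c)
  have hB (j : Fin t) : volume A / t - ENNReal.ofReal c ≤ volume (B j) := by
    have hBfin : volume (B j) ≠ ∞ := ne_top_of_le_ne_top hfin (measure_mono inter_subset_left)
    have hIfin (z : ℝ) : volume (A ∩ Iic z) ≠ ∞ :=
      ne_top_of_le_ne_top hfin (measure_mono inter_subset_left)
    have hsub : A ∩ Iic (w (j + 1)) ⊆
        ((A ∩ Iic (w j)) ∪ B j) ∪ Ioc (w (j + 1) - c) (w (j + 1)) := by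
      rintro z ⟨hzA, hz⟩
      rcases le_or_gt z (w (j + 1) - c) with h | h
      · rcases le_or_gt z (w j) with h' | h'
        · exact Or.inl (Or.inl ⟨hzA, h'⟩)
        · exact Or.inl (Or.inr ⟨hzA, h', h⟩)
      · exact Or.inr ⟨h, hz⟩
    have h1 : volume.real (A ∩ Iic (w (j + 1))) ≤
        volume.real (A ∩ Iic (w j)) + volume.real (B j) + c :=
      calc _ ≤ volume.real (((A ∩ Iic (w j)) ∪ B j) ∪ Ioc (w (j + 1) - c) (w (j + 1))) :=
            measureReal_mono hsub (measure_union_ne_top (measure_union_ne_top (hIfin _) hBfin)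
              (by simp [Real.volume_Ioc]))
        _ ≤ volume.real ((A ∩ Iic (w j)) ∪ B j) +
            volume.real (Ioc (w (j + 1) - c) (w (j + 1))) := measureReal_union_le _ _
        _ ≤ (volume.real (A ∩ Iic (w j)) + volume.real (B j)) + c := by
            gcongr
            · exact measureReal_union_le _ _
            · rw [Real.volume_real_Ioc_of_le (by linarith)]
              linarith
    rw [hw _ j.2, hw _ j.2.le] at h1
    push_cast at h1
    have h2 : volume.real A / t ≤ volume.real (B j) + c := by linarith
    rw [tsub_le_iff_right, ← ENNReal.ofReal_toReal hBfin, ← ENNReal.ofReal_toReal hfin,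
      ← ENNReal.ofReal_natCast, ← ENNReal.ofReal_div_of_pos ht',
      ← ENNReal.ofReal_add ENNReal.toReal_nonneg hc.le]
    exact ENNReal.ofReal_le_ofReal h2
  calc (volume A / t - ENNReal.ofReal c) ^ t
      = ∏ _j : Fin t, (volume A / t - ENNReal.ofReal c) := by simp
    _ ≤ ∏ j, volume (B j) := Finset.prod_le_prod' fun j _ => hB j
    _ = volume (univ.pi B) := (volume_pi_pi B).symm
    _ ≤ volume (separatedTuples t c A) := by
        refine measure_mono fun y hy => ⟨fun j => (hy j (mem_univ j)).1, fun j j' hjj' => ?_⟩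
        have h1 := (hy j (mem_univ j)).2.2
        have h2 := (hy j' (mem_univ j')).2.1
        rw [← hjj'] at h2
        linarith

lemma mul_le_sub_of_consecutive {t : ℕ} {c : ℝ} {y : Fin t → ℝ}
    (hy : ∀ j j' : Fin t, (j : ℕ) + 1 = j' → y j + c ≤ y j') (i : Fin t) (k : ℕ) :
    ∀ j : Fin t, (i : ℕ) + k = j → k * c ≤ y j - y i := by
  induction k with
  | zero =>
    intro j hj
    obtain rfl : i = j := Fin.ext (by simpa using hj)
    simp
  | succ k ih =>
    intro j hj
    have h1 := ih ⟨i + k, by omega⟩ rfl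
    have h2 := hy ⟨i + k, by omega⟩ j (by simpa [add_assoc] using hj)
    push_cast
    linarith

/-- The stack of `t` copies of `P` at heights `c, 2c, …, tc`. -/
def stack {d : ℕ} (t : ℕ) (c : ℝ) (P : Set (Fin d → ℝ)) : Set (Fin (d + 1) → ℝ) :=
  {q | ∃ p ∈ P, ∃ j : Fin t,
    (∀ i : Fin d, q i.castSucc = p i) ∧ q (Fin.last d) = ((j : ℕ) + 1) * c}

lemma DContains.stack {d t : ℕ} {c : ℝ} (hc : 0 < c) {P : Set (Fin d → ℝ)}
    {S : Set (Fin (d + 1) → ℝ)} {y : Fin t → ℝ}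
    (hy : ∀ j j' : Fin t, (j : ℕ) + 1 = j' → y j + c ≤ y j')
    (h : DContains {x : Fin d → ℝ | ∀ j, (Fin.snoc x (y j) : Fin (d + 1) → ℝ) ∈ S} P) :
    DContains S (stack t c P) := by
  obtain ⟨f, hf, hfS⟩ := h
  let height : Fin t → ℝ := fun j => ((j : ℕ) + 1) * c
  have hinj : Function.Injective height := fun i j hij => by
    have := mul_right_cancel₀ hc.ne' hij
    exact Fin.ext (by exact_mod_cast add_right_cancel this)
  let g : ℝ → ℝ := Function.extend height y 0
  have hg (j : Fin t) : g (((j : ℕ) + 1) * c) = y j := hinj.extend_apply y 0 j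
  refine ⟨Fin.snoc (α := fun _ => ℝ → ℝ) f g, fun i => ?_, ?_⟩
  · refine Fin.lastCases ?_ (fun i => ?_) i
    · rintro x x' ⟨q, ⟨p, hp, j, hpj, hj⟩, rfl⟩ ⟨q', ⟨p', hp', j', hpj', hj'⟩, rfl⟩ hlt
      rw [hj, hj'] at hlt ⊢
      simp only [Fin.snoc_last, hg]
      have hlt' : (j' : ℕ) < j := by
        have := lt_of_mul_lt_mul_right hlt hc.le
        exact_mod_cast lt_of_add_lt_add_right this
      obtain ⟨k, hk⟩ := Nat.exists_eq_add_of_lt hlt'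
      have := mul_le_sub_of_consecutive hy j' (k + 1) j (by omega)
      have hcast : ((j : ℕ) : ℝ) = j' + k + 1 := by exact_mod_cast hk
      rw [hcast]
      push_cast at this
      linarith
    · rintro x x' ⟨q, ⟨p, hp, j, hpj, hj⟩, rfl⟩ ⟨q', ⟨p', hp', j', hpj', hj'⟩, rfl⟩ hlt
      simp only [Fin.snoc_castSucc]
      exact hf i _ _ ⟨p, hp, (hpj i).symm⟩ ⟨p', hp', (hpj' i).symm⟩ hlt
  · rintro q ⟨p, hp, j, hpj, hj⟩
    convert hfS p hp j using 1
    ext i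
    refine Fin.lastCases ?_ (fun i => ?_) i
    · simp only [Fin.snoc_last, hj, hg]
    · simp only [Fin.snoc_castSucc, hpj]

lemma volume_eq_lintegral_snoc {d : ℕ} {S : Set (Fin (d + 1) → ℝ)} (hS : MeasurableSet S) :
    volume S = ∫⁻ x : Fin d → ℝ, volume {z : ℝ | (Fin.snoc x z : Fin (d + 1) → ℝ) ∈ S} := by
  have hmp := (volume_preserving_piFinSuccAbove (fun _ : Fin (d + 1) => ℝ) (Fin.last d)).symm
  rw [← hmp.measure_preimage_equiv, Measure.volume_eq_prod,
    Measure.prod_apply_symm ((MeasurableEquiv.measurable _) hS)]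
  refine lintegral_congr fun x => ?_
  congr 1
  ext z
  simp [MeasurableEquiv.piFinSuccAbove, Fin.insertNthEquiv, Fin.insertNth_last']

lemma lintegral_le_rpow_mul_measure {α : Type*} [MeasurableSpace α] {μ : Measure α} {t : ℕ}
    (ht : 2 ≤ t) {g : α → ℝ≥0∞} (hg : AEMeasurable g μ) :
    ∫⁻ x, g x ∂μ ≤ (∫⁻ x, g x ^ t ∂μ) ^ (1 / (t : ℝ)) * μ univ ^ (1 - 1 / (t : ℝ)) := by
  have ht' : (1 : ℝ) < t := by exact_mod_cast ht
  have hpq := Real.HolderConjugate.conjExponent ht'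
  have := ENNReal.lintegral_mul_le_Lp_mul_Lq μ hpq hg (aemeasurable_const (b := (1 : ℝ≥0∞)))
  have hq : 1 / (t : ℝ).conjExponent = 1 - 1 / (t : ℝ) := by
    have := hpq.inv_add_inv_eq_one
    simp only [one_div]
    linarith
  simpa [hq] using this

lemma volume_le_of_not_dContains_stack {d t : ℕ} (ht : 2 ≤ t) {c n : ℝ} (hc : 0 < c)
    (hn : 0 < n) {P : Set (Fin d → ℝ)} {S : Set (Fin (d + 1) → ℝ)} (hSo : IsOpen S)
    (hSn : S ⊆ Icc (fun _ => 0) (fun _ => n)) (hS : ¬ DContains S (stack t c P)) :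
    volume S ≤ ENNReal.ofReal (c * t * n ^ d) +
      ENNReal.ofReal (t : ℝ) * pxD d n P ^ (1 / (t : ℝ)) *
        ENNReal.ofReal (n ^ ((d : ℝ) + 1 - (d : ℝ) / (t : ℝ))) := by
  have ht0 : 0 < t := by omega
  let K : Set (Fin d → ℝ) := Icc (fun _ => 0) (fun _ => n)
  have hK : volume K = ENNReal.ofReal n ^ d := by
    simp [K, Real.volume_Icc_pi]
  let L : (Fin d → ℝ) → Set ℝ := fun x => {z | (Fin.snoc x z : Fin (d + 1) → ℝ) ∈ S}
  have hL (x : Fin d → ℝ) : L x ⊆ Icc 0 n := fun z hz => by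
    have h := hSn hz
    have h1 := h.1 (Fin.last d)
    have h2 := h.2 (Fin.last d)
    simp only [Fin.snoc_last] at h1 h2
    exact ⟨h1, h2⟩
  have hLK (x : Fin d → ℝ) (z : ℝ) (hz : z ∈ L x) : x ∈ K := by
    have h := hSn hz
    refine ⟨fun i => ?_, fun i => ?_⟩
    · simpa using h.1 i.castSucc
    · simpa using h.2 i.castSucc
  have hcont : Continuous fun p : (Fin d → ℝ) × ℝ => (Fin.snoc p.1 p.2 : Fin (d + 1) → ℝ) :=
    Continuous.finSnoc continuous_fst continuous_snd
  have hLmeas : Measurable fun x => volume (L x) :=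
    measurable_measure_prodMk_left (hSo.preimage hcont).measurableSet
  let T : Set ((Fin d → ℝ) × (Fin t → ℝ)) := {p | p.2 ∈ separatedTuples t c (L p.1)}
  have hTmeas : MeasurableSet T := by
    have hT : T = (⋂ j : Fin t, {p | (Fin.snoc p.1 (p.2 j) : Fin (d + 1) → ℝ) ∈ S}) ∩
        ⋂ j : Fin t, ⋂ j' : Fin t, ⋂ _ : (j : ℕ) + 1 = j', {p | p.2 j + c ≤ p.2 j'} := by
      ext p
      simp [T, L, separatedTuples]
    rw [hT]
    refine (MeasurableSet.iInter fun j => ?_).inter (MeasurableSet.iInter fun j =>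
      MeasurableSet.iInter fun j' => MeasurableSet.iInter fun _ => ?_)
    · exact (hSo.preimage (Continuous.finSnoc continuous_fst
        ((continuous_apply j).comp continuous_snd))).measurableSet
    · exact (isClosed_le (by fun_prop) (by fun_prop)).measurableSet
  have hslice (y : Fin t → ℝ) : volume {x | (x, y) ∈ T} ≤
      (Icc (fun _ => 0) (fun _ => n) : Set (Fin t → ℝ)).indicator (fun _ => pxD d n P) y := by
    by_cases hy : ∃ x, (x, y) ∈ T
    · obtain ⟨x, hx⟩ := hy
      have hyn : y ∈ (Icc (fun _ => 0) (fun _ => n) : Set (Fin t → ℝ)) :=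
        ⟨fun j => (hL x (hx.1 j)).1, fun j => (hL x (hx.1 j)).2⟩
      rw [indicator_of_mem hyn]
      let D : Set (Fin d → ℝ) := {x | ∀ j, (Fin.snoc x (y j) : Fin (d + 1) → ℝ) ∈ S}
      have hD : {x | (x, y) ∈ T} ⊆ D := fun x' hx' => hx'.1
      refine (measure_mono hD).trans
        (le_sSup ⟨D, ?_, ?_, fun h => hS (h.stack hc hx.2), rfl⟩)
      · simp only [D, ofPred_forall]
        exact isOpen_iInter_of_finite fun j =>
          hSo.preimage (Continuous.finSnoc continuous_id continuous_const)
      · exact fun x' hx' => hLK x' _ (hx' ⟨0, ht0⟩)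
    · push Not at hy
      simp [hy]
  have hmain : ∫⁻ x in K, (volume (L x) / t - ENNReal.ofReal c) ^ t ≤
      ENNReal.ofReal n ^ t * pxD d n P :=
    calc ∫⁻ x in K, (volume (L x) / t - ENNReal.ofReal c) ^ t
        ≤ ∫⁻ x, (volume (L x) / t - ENNReal.ofReal c) ^ t := setLIntegral_le_lintegral _ _
      _ ≤ ∫⁻ x, volume (Prod.mk x ⁻¹' T) :=
          lintegral_mono fun x => pow_le_volume_separatedTuples ht0 hc hn (hL x)
      _ = volume T := (Measure.prod_apply hTmeas).symm
      _ = ∫⁻ y, volume {x | (x, y) ∈ T} := Measure.prod_apply_symm hTmeas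
      _ ≤ ∫⁻ y, (Icc (fun _ => 0) (fun _ => n) : Set (Fin t → ℝ)).indicator
            (fun _ => pxD d n P) y := lintegral_mono hslice
      _ = ENNReal.ofReal n ^ t * pxD d n P := by
          rw [lintegral_indicator_const measurableSet_Icc, Real.volume_Icc_pi]
          simp [mul_comm]
  have hsplit (m : ℝ≥0∞) :
      m ≤ t * (m / t - ENNReal.ofReal c) + t * ENNReal.ofReal c := by
    rw [← mul_add]
    calc m = t * (m / t) :=
          (ENNReal.mul_div_cancel (by exact_mod_cast ht0.ne') (by simp)).symm
      _ ≤ _ := by gcongr; exact le_tsub_add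
  have hgmeas : Measurable fun x => volume (L x) / t - ENNReal.ofReal c :=
    (hLmeas.div_const _).sub_const _
  have hHolder := lintegral_le_rpow_mul_measure (μ := volume.restrict K) ht hgmeas.aemeasurable
  rw [Measure.restrict_apply_univ, hK] at hHolder
  have hpow : (ENNReal.ofReal n ^ t * pxD d n P) ^ (1 / (t : ℝ)) *
      (ENNReal.ofReal n ^ d) ^ (1 - 1 / (t : ℝ)) =
      pxD d n P ^ (1 / (t : ℝ)) *
        ENNReal.ofReal (n ^ ((d : ℝ) + 1 - (d : ℝ) / (t : ℝ))) := by
    have hn0 : ENNReal.ofReal n ≠ 0 := by simpa using hn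
    rw [ENNReal.mul_rpow_of_nonneg _ _ (by positivity), ← ENNReal.rpow_natCast,
      ← ENNReal.rpow_natCast, ← ENNReal.rpow_mul, ← ENNReal.rpow_mul,
      ← ENNReal.ofReal_rpow_of_pos hn, mul_comm (_ ^ _) (pxD d n P ^ _), mul_assoc,
      ← ENNReal.rpow_add _ _ hn0 ENNReal.ofReal_ne_top]
    congr 2
    field_simp
    ring
  calc volume S = ∫⁻ x, volume (L x) := volume_eq_lintegral_snoc hSo.measurableSet
    _ = ∫⁻ x in K, volume (L x) := by
        rw [← lintegral_indicator measurableSet_Icc]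
        refine lintegral_congr fun x => ?_
        by_cases hx : x ∈ K
        · rw [indicator_of_mem hx]
        · have : L x = ∅ := eq_empty_of_forall_notMem fun z hz => hx (hLK x z hz)
          rw [indicator_of_notMem hx, this, measure_empty]
    _ ≤ ∫⁻ x in K, (t * (volume (L x) / t - ENNReal.ofReal c) + t * ENNReal.ofReal c) :=
        lintegral_mono fun x => hsplit _
    _ = t * (∫⁻ x in K, (volume (L x) / t - ENNReal.ofReal c)) +
          t * ENNReal.ofReal c * ENNReal.ofReal n ^ d := by
        rw [lintegral_add_right _ measurable_const, lintegral_const_mul _ hgmeas,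
          setLIntegral_const, hK]
    _ ≤ t * (pxD d n P ^ (1 / (t : ℝ)) *
          ENNReal.ofReal (n ^ ((d : ℝ) + 1 - (d : ℝ) / (t : ℝ)))) +
          t * ENNReal.ofReal c * ENNReal.ofReal n ^ d := by
        rw [← hpow]
        gcongr
        exact hHolder.trans (by gcongr)
    _ = _ := by
        rw [ENNReal.ofReal_mul (by positivity), ENNReal.ofReal_mul hc.le,
          ENNReal.ofReal_pow hn.le, ENNReal.ofReal_natCast, add_comm, mul_assoc (t : ℝ≥0∞) (_ ^ _),
          mul_comm (t : ℝ≥0∞) (ENNReal.ofReal c)]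

theorem pxD_stacked_kst (d t : ℕ) (hd : 1 ≤ d) (ht : 2 ≤ t) (c : ℝ) (hc : 0 < c)
    (P : Set (Fin d → ℝ)) :
    ∀ n : ℝ, 0 < n →
      pxD (d + 1) n {q : Fin (d + 1) → ℝ | ∃ p ∈ P, ∃ j : Fin t,
          (∀ i : Fin d, q i.castSucc = p i) ∧ q (Fin.last d) = ((j : ℕ) + 1) * c} ≤
        ENNReal.ofReal (c * t * n ^ d) +
          ENNReal.ofReal (t : ℝ) * pxD d n P ^ (1 / (t : ℝ)) *
            ENNReal.ofReal (n ^ ((d : ℝ) + 1 - (d : ℝ) / (t : ℝ))) := by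
  intro n hn
  refine sSup_le ?_
  rintro m ⟨S, hSo, hSn, hS, rfl⟩
  exact volume_le_of_not_dContains_stack ht hc hn hSo hSn hS
end
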